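/- arXiv:2105.03730 — 8 statements merged into one kernel-verified Lean document; each statement's English description precedes it below -/
import Mathlib

section
/- Let M be a topological space with binary relations ≺ (chronology) and ⪯ (causality) such that each set I⁺(x) = {y ∈ M | x ≺ y} is open and the push-up property holds: if x ⪯ y and y ≺ z then x ≺ z. Let Γ be a subset of M and let B⁺(Γ) = {q ∈ M | Γ ⊆ ∂I⁺(q)}, where ∂S denotes the topological frontier of S. Then B⁺(Γ) is causally convex: whenever r ⪯ q ⪯ s with r, s ∈ B⁺(Γ), also q ∈ B⁺(Γ). -/
/-- Proposition 2.6 (first assertion): B⁺(Γ) is causally convex. -/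
theorem Bplus_causallyConvex {M : Type*} [TopologicalSpace M]
    (chron caus : M → M → Prop)
    (hIplus_open : ∀ x : M, IsOpen {y : M | chron x y})
    (pushup : ∀ x y z : M, caus x y → chron y z → chron x z)
    (Γ : Set M)
    (r q s : M)
    (hr : r ∈ {q : M | Γ ⊆ frontier {y : M | chron q y}})
    (hs : s ∈ {q : M | Γ ⊆ frontier {y : M | chron q y}})
    (hrq : caus r q) (hqs : caus q s) :
    q ∈ {q : M | Γ ⊆ frontier {y : M | chron q y}} := by
  intro x hx
  have hxs := hs hx
  have hxr := hr hx
  rw [(hIplus_open _).frontier_eq] at hxs hxr ⊢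
  exact ⟨closure_mono (fun y hy => pushup q s y hqs hy) hxs.1,
    fun hxq => hxr.2 (pushup r q x hrq hxq)⟩
end

section
/- Let M be a topological space with binary relations ≺ (chronology) and ⪯ (causality) such that each set I⁻(x) = {y ∈ M | y ≺ x} is open and the push-up property holds: if x ≺ y and y ⪯ z then x ≺ z. Let Γ be a subset of M and let B⁻(Γ) = {q ∈ M | Γ ⊆ ∂I⁻(q)}, where ∂S denotes the topological frontier of S. Then B⁻(Γ) is causally convex: whenever r ⪯ q ⪯ s with r, s ∈ B⁻(Γ), also q ∈ B⁻(Γ). -/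
theorem frontier_inter_frontier_subset_of_subset {X : Type*} [TopologicalSpace X] {s t u : Set X}
    (hst : s ⊆ t) (htu : t ⊆ u) : frontier s ∩ frontier u ⊆ frontier t :=
  fun _ hx => ⟨closure_mono hst hx.1.1, fun ht => hx.2.2 (interior_mono htu ht)⟩

/-- Proposition 2.6 (first assertion, time-dual): B⁻(Γ) is causally convex. -/
theorem Bminus_causallyConvex {M : Type*} [TopologicalSpace M]
    (chron caus : M → M → Prop)
    (hIminus_open : ∀ x : M, IsOpen {y : M | chron y x})
    (pushup : ∀ x y z : M, chron x y → caus y z → chron x z)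
    (Γ : Set M)
    (r q s : M)
    (hr : r ∈ {q : M | Γ ⊆ frontier {y : M | chron y q}})
    (hs : s ∈ {q : M | Γ ⊆ frontier {y : M | chron y q}})
    (hrq : caus r q) (hqs : caus q s) :
    q ∈ {q : M | Γ ⊆ frontier {y : M | chron y q}} := by
  exact fun _ hx => frontier_inter_frontier_subset_of_subset
    (fun y hy => pushup y r q hy hrq) (fun y hy => pushup y q s hy hqs) ⟨hr hx, hs hx⟩
end

section
/- Let M be a topological space with a binary relation ≺ (chronology) such that each set I⁺(x) = {y ∈ M | x ≺ y} and each set I⁻(x) = {y ∈ M | y ≺ x} is open, and such that I⁺ is outer continuous: for every c ∈ M and every compact set K contained in the complement of the closure of I⁺(c), there exists an open neighborhood U of c such that for every q ∈ U, K is contained in the complement of the closure of I⁺(q). Let Γ be a subset of M and let B⁺(Γ) = {q ∈ M | Γ ⊆ ∂I⁺(q)}, where ∂S denotes the topological frontier of S. Then B⁺(Γ) is a closed subset of M. -/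
/-- Proposition 2.6 (second assertion): if I⁺, I⁻ are open-valued and I⁺ is outer
continuous, then B⁺(Γ) is closed. -/
theorem Bplus_isClosed {M : Type*} [TopologicalSpace M]
    (chron : M → M → Prop)
    (hIplus_open : ∀ x : M, IsOpen {y : M | chron x y})
    (hIminus_open : ∀ x : M, IsOpen {y : M | chron y x})
    (houter : ∀ c : M, ∀ K : Set M, IsCompact K →
      K ⊆ (closure {y : M | chron c y})ᶜ →
      ∃ U : Set M, IsOpen U ∧ c ∈ U ∧
        ∀ q ∈ U, K ⊆ (closure {y : M | chron q y})ᶜ)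
    (Γ : Set M) :
    IsClosed {q : M | Γ ⊆ frontier {y : M | chron q y}} := by
  rw [← isOpen_compl_iff, isOpen_iff_mem_nhds]
  intro c hc
  simp only [Set.mem_compl_iff, Set.mem_ofPred_eq, Set.not_subset] at hc
  obtain ⟨p, hpΓ, hp⟩ := hc
  rw [(hIplus_open c).frontier_eq] at hp
  by_cases hcp : chron c p
  · filter_upwards [(hIminus_open p).mem_nhds hcp] with q hqp hq
    have hpq := hq hpΓ
    rw [(hIplus_open q).frontier_eq] at hpq
    exact hpq.2 hqp
  · have hpc : p ∉ closure {y : M | chron c y} := fun h => hp ⟨h, hcp⟩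
    obtain ⟨U, hU, hcU, hUp⟩ :=
      houter c {p} isCompact_singleton (Set.singleton_subset_iff.2 hpc)
    filter_upwards [hU.mem_nhds hcU] with q hqU hq
    exact hUp q hqU rfl (frontier_subset_closure (hq hpΓ))
end

section
/- Let M be a topological space with a binary relation ≺ (chronology) such that each set I⁺(x) = {y ∈ M | x ≺ y} and each set I⁻(x) = {y ∈ M | y ≺ x} is open, and such that I⁻ is outer continuous: for every c ∈ M and every compact set K contained in the complement of the closure of I⁻(c), there exists an open neighborhood U of c such that for every q ∈ U, K is contained in the complement of the closure of I⁻(q). Let Γ be a subset of M and let B⁻(Γ) = {q ∈ M | Γ ⊆ ∂I⁻(q)}, where ∂S denotes the topological frontier of S. Then B⁻(Γ) is a closed subset of M. -/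
/-- Proposition 2.6 (second assertion, time-dual): if I⁺, I⁻ are open-valued and I⁻
is outer continuous, then B⁻(Γ) is closed. -/
theorem Bminus_isClosed {M : Type*} [TopologicalSpace M]
    (chron : M → M → Prop)
    (hIplus_open : ∀ x : M, IsOpen {y : M | chron x y})
    (hIminus_open : ∀ x : M, IsOpen {y : M | chron y x})
    (houter : ∀ c : M, ∀ K : Set M, IsCompact K →
      K ⊆ (closure {y : M | chron y c})ᶜ →
      ∃ U : Set M, IsOpen U ∧ c ∈ U ∧
        ∀ q ∈ U, K ⊆ (closure {y : M | chron y q})ᶜ)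
    (Γ : Set M) :
    IsClosed {q : M | Γ ⊆ frontier {y : M | chron y q}} := by
  have hclosure : ∀ x : M, IsClosed {q : M | x ∈ closure {y : M | chron y q}} := by
    intro x
    rw [← isOpen_compl_iff, isOpen_iff_forall_mem_open]
    intro c hc
    obtain ⟨U, hU, hcU, hUK⟩ := houter c {x} isCompact_singleton (Set.singleton_subset_iff.2 hc)
    exact ⟨U, fun q hq => hUK q hq (Set.mem_singleton x), hU, hcU⟩
  have heq : {q : M | Γ ⊆ frontier {y : M | chron y q}} =
      ⋂ x ∈ Γ, {q : M | x ∈ closure {y : M | chron y q}} ∩ {q : M | chron x q}ᶜ := by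
    ext q
    simp [(hIminus_open q).frontier_eq, Set.subset_def]
  rw [heq]
  exact isClosed_biInter fun x _ => (hclosure x).inter (hIplus_open x).isClosed_compl
end

section
/- Let M be a topological space with a transitive binary relation ≺ (chronology) such that each set I⁺(x) = {y ∈ M | x ≺ y} is open and such that M is reflecting in the form: for all v, w ∈ M, v belongs to the closure of I⁺(w) if and only if w belongs to the closure of I⁻(v). Let Γ be a subset of M and let B⁺(Γ) = {q ∈ M | Γ ⊆ ∂I⁺(q)}, where ∂S denotes the topological frontier of S. Then for every p ∈ B⁺(Γ) and every w ∈ I⁺(p), the intersection Γ ∩ ∂I⁺(w) is empty; that is, M is a nakedly singular past boundary at every point of B⁺(Γ). -/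
/-- Proposition 2.9(I): in a reflecting spacetime, M is a nakedly singular past
boundary at every point of B⁺(Γ). -/
theorem nakedly_singular_past_boundary {M : Type*} [TopologicalSpace M]
    (chron : M → M → Prop)
    (htrans : ∀ x y z : M, chron x y → chron y z → chron x z)
    (hIplus_open : ∀ x : M, IsOpen {y : M | chron x y})
    (hreflect : ∀ v w : M, v ∈ closure {y : M | chron w y} ↔
      w ∈ closure {y : M | chron y v})
    (Γ : Set M)
    (p : M) (hp : p ∈ {q : M | Γ ⊆ frontier {y : M | chron q y}})
    (w : M) (hw : w ∈ {y : M | chron p y}) :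
    Γ ∩ frontier {y : M | chron w y} = ∅ := by
  refine Set.eq_empty_iff_forall_notMem.mpr ?_
  rintro x ⟨hxΓ, hxw⟩
  obtain ⟨z, hpz, hzx⟩ :=
    mem_closure_iff.mp ((hreflect x w).mp (frontier_subset_closure hxw)) _ (hIplus_open p) hw
  have hx : x ∈ frontier {y : M | chron p y} := hp hxΓ
  rw [(hIplus_open p).frontier_eq] at hx
  exact hx.2 (htrans p z x hpz hzx)
end

section
/- Let M be a topological space with a transitive binary relation ≺ (chronology) such that each set I⁻(x) = {y ∈ M | y ≺ x} is open and such that M is reflecting in the form: for all v, w ∈ M, v belongs to the closure of I⁺(w) if and only if w belongs to the closure of I⁻(v). Let Γ be a subset of M and let B⁻(Γ) = {q ∈ M | Γ ⊆ ∂I⁻(q)}, where ∂S denotes the topological frontier of S. Then for every p ∈ B⁻(Γ) and every w ∈ I⁻(p), the intersection Γ ∩ ∂I⁻(w) is empty; that is, M is a nakedly singular future boundary at every point of B⁻(Γ). -/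
/-- Proposition 2.9(I), time-dual: in a reflecting spacetime, M is a nakedly singular
future boundary at every point of B⁻(Γ). -/
theorem nakedly_singular_future_boundary {M : Type*} [TopologicalSpace M]
    (chron : M → M → Prop)
    (htrans : ∀ x y z : M, chron x y → chron y z → chron x z)
    (hIminus_open : ∀ x : M, IsOpen {y : M | chron y x})
    (hreflect : ∀ v w : M, v ∈ closure {y : M | chron w y} ↔
      w ∈ closure {y : M | chron y v})
    (Γ : Set M)
    (p : M) (hp : p ∈ {q : M | Γ ⊆ frontier {y : M | chron y q}})
    (w : M) (hw : w ∈ {y : M | chron y p}) :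
    Γ ∩ frontier {y : M | chron y w} = ∅ := by
  refine Set.eq_empty_of_forall_notMem fun x hx => ?_
  obtain ⟨y, hyp, hxy⟩ := mem_closure_iff.1 ((hreflect w x).2 hx.2.1) _ (hIminus_open p) hw
  have hxp : x ∈ frontier {y : M | chron y p} := hp hx.1
  rw [(hIminus_open p).frontier_eq] at hxp
  exact hxp.2 (htrans x y p hxy hyp)
end

section
/- Let M be a topological space with a transitive binary relation ≺ (chronology) such that each set I⁺(x) = {y ∈ M | x ≺ y} is open, such that every point p ∈ M belongs to the closure of I⁺(p), and such that M is reflecting in the form: for all v, w ∈ M, v belongs to the closure of I⁺(w) if and only if w belongs to the closure of I⁻(v). Let Γ be a nonempty subset of M and let B⁺(Γ) = {q ∈ M | Γ ⊆ ∂I⁺(q)}, where ∂S denotes the topological frontier of S. Then the interior of B⁺(Γ) is empty. -/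
/-- Proposition 2.9(II), first claim: B⁺(Γ) has empty interior. -/
theorem Bplus_interior_empty {M : Type*} [TopologicalSpace M]
    (chron : M → M → Prop)
    (htrans : ∀ x y z : M, chron x y → chron y z → chron x z)
    (hIplus_open : ∀ x : M, IsOpen {y : M | chron x y})
    (hself : ∀ p : M, p ∈ closure {y : M | chron p y})
    (hreflect : ∀ v w : M, v ∈ closure {y : M | chron w y} ↔
      w ∈ closure {y : M | chron y v})
    (Γ : Set M) (hΓ : Γ.Nonempty) :
    interior {q : M | Γ ⊆ frontier {y : M | chron q y}} = ∅ := by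
  refine Set.eq_empty_iff_forall_notMem.mpr fun q hq => ?_
  obtain ⟨p, hp⟩ := hΓ
  obtain ⟨r, hr, hqr⟩ := mem_closure_iff.mp (hself q) _ isOpen_interior hq
  have hrp : r ∈ closure {y : M | chron y p} :=
    (hreflect p r).mp (frontier_subset_closure (interior_subset hr hp))
  obtain ⟨s, hqs, hsp⟩ := mem_closure_iff.mp hrp _ (hIplus_open q) hqr
  have hqp : p ∈ frontier {y : M | chron q y} := interior_subset hq hp
  rw [(hIplus_open q).frontier_eq] at hqp
  exact hqp.2 (htrans q s p hqs hsp)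
end

section
/- Let M be a topological space with a transitive binary relation ≺ (chronology) such that each set I⁺(x) = {y ∈ M | x ≺ y} and each set I⁻(x) = {y ∈ M | y ≺ x} is open, such that every point p ∈ M belongs to the closure of I⁺(p), such that M is reflecting in the form: for all v, w ∈ M, v belongs to the closure of I⁺(w) if and only if w belongs to the closure of I⁻(v), and such that I⁺ is outer continuous: for every c ∈ M and every compact set K contained in the complement of the closure of I⁺(c), there exists an open neighborhood U of c such that for every q ∈ U, K is contained in the complement of the closure of I⁺(q). Let Γ be a nonempty subset of M and let B⁺(Γ) = {q ∈ M | Γ ⊆ ∂I⁺(q)}, where ∂S denotes the topological frontier of S. Then the topological frontier of B⁺(Γ) equals B⁺(Γ). -/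
/-- Proposition 2.9(II), second claim: the frontier of B⁺(Γ) equals B⁺(Γ). -/
theorem Bplus_frontier_eq {M : Type*} [TopologicalSpace M]
    (chron : M → M → Prop)
    (htrans : ∀ x y z : M, chron x y → chron y z → chron x z)
    (hIplus_open : ∀ x : M, IsOpen {y : M | chron x y})
    (hIminus_open : ∀ x : M, IsOpen {y : M | chron y x})
    (hself : ∀ p : M, p ∈ closure {y : M | chron p y})
    (hreflect : ∀ v w : M, v ∈ closure {y : M | chron w y} ↔
      w ∈ closure {y : M | chron y v})
    (houter : ∀ c : M, ∀ K : Set M, IsCompact K →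
      K ⊆ (closure {y : M | chron c y})ᶜ →
      ∃ U : Set M, IsOpen U ∧ c ∈ U ∧
        ∀ q ∈ U, K ⊆ (closure {y : M | chron q y})ᶜ)
    (Γ : Set M) (hΓ : Γ.Nonempty) :
    frontier {q : M | Γ ⊆ frontier {y : M | chron q y}} =
      {q : M | Γ ⊆ frontier {y : M | chron q y}} := by
  have mem_iff : ∀ q γ : M, γ ∈ frontier {y : M | chron q y} ↔
      q ∈ closure {y : M | chron y γ} \ {y : M | chron y γ} := fun q γ => by
    rw [(hIplus_open q).frontier_eq, Set.mem_sdiff, hreflect γ q, Set.mem_sdiff]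
    rfl
  have hB : {q : M | Γ ⊆ frontier {y : M | chron q y}} =
      ⋂ γ ∈ Γ, frontier {y : M | chron y γ} := by
    ext q
    simp only [Set.mem_iInter, (hIminus_open _).frontier_eq]
    exact forall₂_congr fun γ _ => mem_iff q γ
  obtain ⟨γ, hγ⟩ := hΓ
  have hclosed : IsClosed (⋂ γ ∈ Γ, frontier {y : M | chron y γ}) :=
    isClosed_biInter fun _ _ => isClosed_frontier
  have hint : interior (⋂ γ ∈ Γ, frontier {y : M | chron y γ}) = ∅ :=
    Set.subset_empty_iff.mp <|
      (interior_mono (Set.biInter_subset_of_mem hγ)).trans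
        (frontier_compl {y : M | chron y γ} ▸
          interior_frontier (hIminus_open γ).isClosed_compl).subset
  rw [hB, hclosed.frontier_eq, hint, Set.sdiff_empty]
end
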